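/- arXiv:1505.04393 — 3 statements merged into one kernel-verified Lean document; each statement's English description precedes it below -/
import Mathlib

section
/- Let X be a type equipped with a ternary operation ν : X × X × X → X that is totally associative (ν(ν(x,y,z),t,u) = ν(x,ν(y,z,t),u) = ν(x,y,ν(z,t,u)) for all x,y,z,t,u), fully commutative (ν(x,y,z) is invariant under all permutations of its three arguments), and such that for all a,b,c ∈ X the equation ν(a,b,x) = c has a unique solution x. Suppose there exists an element 0 ∈ X with ν(0,0,x) = x for all x ∈ X. Then the binary operation a + b := ν(a,0,b) makes X into an abelian group with identity element 0, and ν is derived from it: ν(x,y,z) = (x + y) + z for all x,y,z ∈ X. -/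
/-- A commutative ternary group `⟨X, ν⟩` with a ternary zero `0` is derived from
a binary addition `a + b := ν a 0 b` making `X` an abelian group with identity `0`. -/
theorem stmt_1 {X : Type*} (ν : X → X → X → X)
    (hassoc : ∀ x y z t u : X,
      ν (ν x y z) t u = ν x (ν y z t) u ∧ ν x (ν y z t) u = ν x y (ν z t u))
    (hcomm : ∀ (x y z : X) (σ : Equiv.Perm (Fin 3)),
      ν x y z = ν (![x, y, z] (σ 0)) (![x, y, z] (σ 1)) (![x, y, z] (σ 2)))
    (hsolv : ∀ a b c : X, ∃! x : X, ν a b x = c)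
    (z : X) (hz : ∀ x : X, ν z z x = x) :
    (∀ a b c : X, ν (ν a z b) z c = ν a z (ν b z c)) ∧
    (∀ a b : X, ν a z b = ν b z a) ∧
    (∀ a : X, ν z z a = a ∧ ν a z z = a) ∧
    (∀ a : X, ∃ b : X, ν a z b = z) ∧
    (∀ x y t : X, ν x y t = ν (ν x z y) z t) := by
  have swap_outer : ∀ a b c : X, ν a b c = ν c b a := fun a b c => by
    simpa [Equiv.swap_apply_def] using hcomm a b c (Equiv.swap 0 2)
  have swap_right : ∀ a b c : X, ν a b c = ν a c b := fun a b c => by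
    simpa [Equiv.swap_apply_def] using hcomm a b c (Equiv.swap 1 2)
  refine ⟨fun a b c => ?_, fun a b => swap_outer a z b, fun a => ⟨hz a, ?_⟩,
    fun a => (hsolv a z z).exists, fun x y t => ?_⟩
  · rw [(hassoc a z b z c).1, (hassoc a z b z c).2]
  · rw [swap_outer, hz]
  · rw [swap_right x z y, (hassoc x y z z t).1, (hassoc x y z z t).2, hz]
end

section
/- Let Q be a polynomial over the field ℤ/2ℤ. Then the quotient ring (ℤ/2ℤ)[x] / ⟨Q⟩ is a local ring whose residue field has exactly two elements and in which the image of x is a unit, if and only if Q = (x+1)ⁿ for some integer n ≥ 1. -/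
open Polynomial in
/-- Modulo `x + 1`, every polynomial over `ℤ/2ℤ` is congruent to `0` or to `1`. -/
theorem X_add_one_dvd_or_dvd_sub_one (p : Polynomial (ZMod 2)) :
    X + 1 ∣ p ∨ X + 1 ∣ p - 1 := by
  have key : (X + 1 : Polynomial (ZMod 2)) = X - C 1 := by
    rw [C_1, CharTwo.sub_eq_add]
  have h2 : ∀ a : ZMod 2, a = 0 ∨ a = 1 := by decide
  rw [key, dvd_iff_isRoot, dvd_iff_isRoot]
  rcases h2 (p.eval 1) with h | h
  · exact Or.inl h
  · exact Or.inr (by simp [IsRoot, h])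

open Polynomial in
/-- If the image of `x + 1` in `R` is nilpotent, a polynomial congruent to `1` modulo `x + 1`
has invertible image. -/
theorem isUnit_map_of_X_add_one_dvd_sub_one {R : Type*} [CommRing R]
    (f : Polynomial (ZMod 2) →+* R) (hf : IsNilpotent (f (X + 1))) {p : Polynomial (ZMod 2)}
    (hp : X + 1 ∣ p - 1) : IsUnit (f p) := by
  obtain ⟨q, hq⟩ := hp
  have hfp : f p = f (X + 1) * f q + 1 := by
    rw [← map_mul, ← hq, map_sub, map_one, sub_add_cancel]
  rw [hfp]
  exact ((Commute.all _ _).isNilpotent_mul_right hf).isUnit_add_one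

open Polynomial in
/-- The quotient `(ℤ/2ℤ)[x]/⟨Q⟩` is a local ring with residue field `ℤ/2ℤ` in which
the image of `x` is a unit, iff `Q = (x+1)ⁿ` for some `n ≥ 1`. -/
theorem stmt_12 (Q : Polynomial (ZMod 2)) :
    (∃ _ : IsLocalRing (Polynomial (ZMod 2) ⧸ Ideal.span {Q}),
        Nat.card (IsLocalRing.ResidueField (Polynomial (ZMod 2) ⧸ Ideal.span {Q})) = 2 ∧
        IsUnit (Ideal.Quotient.mk (Ideal.span {Q}) (X : Polynomial (ZMod 2)))) ↔
      ∃ n : ℕ, 1 ≤ n ∧ Q = (X + 1) ^ n := by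
  have hX1 : (X + 1 : Polynomial (ZMod 2)).Monic := by simpa using monic_X_add_C (1 : ZMod 2)
  have hnu : ¬ IsUnit (X + 1 : Polynomial (ZMod 2)) := by
    simpa using not_isUnit_X_add_C (1 : ZMod 2)
  have isUnit_of_dvd : ∀ g, g ∣ Q → IsUnit (Ideal.Quotient.mk (Ideal.span {Q}) g) →
      IsUnit g := by
    intro g hg hu
    obtain ⟨b, hb⟩ := hu.exists_right_inv
    obtain ⟨h, rfl⟩ := Ideal.Quotient.mk_surjective b
    rw [← map_mul, ← map_one (Ideal.Quotient.mk (Ideal.span {Q})), Ideal.Quotient.eq,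
      Ideal.mem_span_singleton] at hb
    exact isUnit_of_dvd_one ((dvd_sub_right (dvd_mul_right g h)).mp (hg.trans hb))
  constructor
  · rintro ⟨_, hcard, hX⟩
    have hQ0 : Q ≠ 0 := by
      rintro rfl
      exact not_isUnit_X (isUnit_of_dvd X (dvd_zero X) hX)
    set f := (IsLocalRing.residue (Polynomial (ZMod 2) ⧸ Ideal.span {Q})).comp
      (Ideal.Quotient.mk (Ideal.span {Q})) with hf
    have hfX : f X ≠ 0 := (hX.map (IsLocalRing.residue _)).ne_zero
    have hfX1 : f X = 1 := by
      obtain ⟨y, -, hy⟩ := (Nat.card_eq_two_iff' (0 : IsLocalRing.ResidueField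
        (Polynomial (ZMod 2) ⧸ Ideal.span {Q}))).mp hcard
      exact (hy _ hfX).trans (hy _ one_ne_zero).symm
    have hf0 : f (X + 1) = 0 := by
      have : f (X + 1) = f (C (1 + 1)) := by simp [hfX1]
      rw [this, CharTwo.add_self_eq_zero, C_0, map_zero]
    obtain ⟨g, hQ, hg⟩ :=
      (FiniteMultiplicity.of_not_isUnit hnu hQ0).exists_eq_pow_mul_and_not_dvd
    have hgu : IsUnit g := by
      refine isUnit_of_dvd g ⟨_, hQ.trans (mul_comm _ _)⟩ ?_
      rw [← IsLocalRing.residue_ne_zero_iff_isUnit]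
      exact (isUnit_map_of_X_add_one_dvd_sub_one f (hf0 ▸ IsNilpotent.zero)
        ((X_add_one_dvd_or_dvd_sub_one g).resolve_left hg)).ne_zero
    have hg1 : g = 1 := by
      obtain ⟨r, hr, rfl⟩ := isUnit_iff.mp hgu
      have h2 : ∀ a : ZMod 2, a ≠ 0 → a = 1 := by decide
      rw [h2 r hr.ne_zero, C_1]
    rw [hg1, mul_one] at hQ
    refine ⟨_, Nat.one_le_iff_ne_zero.mpr fun h => ?_, hQ⟩
    rw [h, pow_zero] at hQ
    have hnt : Nontrivial (Polynomial (ZMod 2) ⧸ Ideal.span {Q}) := inferInstance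
    rw [Ideal.Quotient.nontrivial_iff, Ne, Ideal.span_singleton_eq_top] at hnt
    exact hnt (hQ ▸ isUnit_one)
  · rintro ⟨n, hn, rfl⟩
    have hnil : IsNilpotent (Ideal.Quotient.mk (Ideal.span {(X + 1) ^ n})
        (X + 1 : Polynomial (ZMod 2))) :=
      ⟨n, by rw [← map_pow, Ideal.Quotient.eq_zero_iff_mem]
             exact Ideal.mem_span_singleton_self _⟩
    have : Nontrivial (Polynomial (ZMod 2) ⧸ Ideal.span {(X + 1 : Polynomial (ZMod 2)) ^ n}) := by
      rw [Ideal.Quotient.nontrivial_iff, Ne, Ideal.span_singleton_eq_top,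
        isUnit_pow_iff (by omega)]
      exact hnu
    have hloc : IsLocalRing (Polynomial (ZMod 2) ⧸
        Ideal.span {(X + 1 : Polynomial (ZMod 2)) ^ n}) := by
      refine IsLocalRing.of_isUnit_or_isUnit_one_sub_self fun a => ?_
      obtain ⟨p, rfl⟩ := Ideal.Quotient.mk_surjective a
      rcases X_add_one_dvd_or_dvd_sub_one p with h | h
      · right
        rw [← map_one (Ideal.Quotient.mk _), ← map_sub]
        exact isUnit_map_of_X_add_one_dvd_sub_one _ hnil (by simpa using h)
      · exact Or.inl (isUnit_map_of_X_add_one_dvd_sub_one _ hnil h)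
    refine ⟨hloc, ?_, isUnit_map_of_X_add_one_dvd_sub_one _ hnil
      (by rw [CharTwo.sub_eq_add])⟩
    rw [Nat.card_eq_two_iff]
    refine ⟨0, 1, zero_ne_one, Set.eq_univ_of_forall fun a => ?_⟩
    obtain ⟨b, rfl⟩ := IsLocalRing.residue_surjective a
    obtain ⟨p, rfl⟩ := Ideal.Quotient.mk_surjective b
    have h0 := (hnil.map (IsLocalRing.residue _)).eq_zero
    rcases X_add_one_dvd_or_dvd_sub_one p with ⟨q, rfl⟩ | ⟨q, hq⟩
    · left
      rw [map_mul, map_mul, h0, zero_mul]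
    · right
      rw [sub_eq_iff_eq_add.mp hq, map_add, map_add, map_mul, map_mul, h0, zero_mul, zero_add,
        map_one, map_one, Set.mem_singleton_iff]
end

section
/- Let R be a commutative local ring whose residue field has exactly two elements, and let q = a₀ + a₁·i + a₂·j + a₃·k be an element of the quaternion algebra ℍ[R] over R (with i² = j² = k² = −1 and i·j·k = −1). If a₀ + a₁ + a₂ + a₃ is a unit of R, then q is a unit of ℍ[R]. -/
/-- A quaternion whose norm is a unit of the base ring is itself a unit. -/
theorem Quaternion.isUnit_of_isUnit_normSq {R : Type*} [CommRing R] {q : Quaternion R}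
    (h : IsUnit (Quaternion.normSq q)) : IsUnit q := by
  have hq : IsUnit ((Quaternion.normSq q : R) : Quaternion R) :=
    h.map (algebraMap R (Quaternion R))
  have hcomm : Commute q (star q) := by
    rw [Commute, SemiconjBy, Quaternion.self_mul_star, Quaternion.star_mul_self]
  rw [← Quaternion.self_mul_star] at hq
  exact (hcomm.isUnit_mul_iff.mp hq).1

open Quaternion in
/-- Over a commutative local ring `R` with residue field `ℤ/2ℤ`, a quaternion
`a₀ + a₁·i + a₂·j + a₃·k` whose coefficient sum is a unit of `R` is a unit of `ℍ[R]`. -/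
theorem stmt_18 {R : Type*} [CommRing R] [IsLocalRing R]
    (hres : Nat.card (IsLocalRing.ResidueField R) = 2)
    (a₀ a₁ a₂ a₃ : R) (h : IsUnit (a₀ + a₁ + a₂ + a₃)) :
    IsUnit (⟨a₀, a₁, a₂, a₃⟩ : ℍ[R]) := by
  have hsq (x : IsLocalRing.ResidueField R) : x ^ 2 = x := by
    have : Finite (IsLocalRing.ResidueField R) := Nat.finite_of_card_ne_zero (by simp [hres])
    have := Fintype.ofFinite (IsLocalRing.ResidueField R)
    rw [← hres, Nat.card_eq_fintype_card, FiniteField.pow_card]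
  apply Quaternion.isUnit_of_isUnit_normSq
  rw [← IsLocalRing.residue_ne_zero_iff_isUnit] at h ⊢
  have hnorm : Quaternion.normSq (⟨a₀, a₁, a₂, a₃⟩ : ℍ[R]) = a₀ ^ 2 + a₁ ^ 2 + a₂ ^ 2 + a₃ ^ 2 :=
    Quaternion.normSq_def' _
  rw [hnorm]
  simpa only [map_add, map_pow, hsq] using h
end
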